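/- Let P ∈ K[x] be a polynomial of degree d such that P([n]_q) ∈ ℤ[q] for all n ∈ {0, 1, …, d}. Then: (1) P([n]_q) ∈ ℤ[q] for all n ∈ ℕ, and (2) P([n]_q) ∈ ℤ[q, q⁻¹] for all n ∈ ℤ. -/

import Mathlib

open Polynomial

noncomputable section

/-- `K = ℚ(q)`, the field of rational functions in `q` over `ℚ`. -/
abbrev K : Type := RatFunc ℚ

/-- The variable `q ∈ K`. -/
def qq : K := RatFunc.X

/-- The quantum integer `[n]_q = (q^n - 1)/(q - 1) ∈ K`, for `n ∈ ℤ`. -/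
def qInt (n : ℤ) : K := (qq ^ n - 1) / (qq - 1)

/-- The subring `ℤ[q]` of `K`. -/
def Zq : Subring K := Subring.closure {qq}

/-- The subring `ℤ[q,q⁻¹]` of Laurent polynomials in `q` inside `K`. -/
def ZqL : Subring K := Subring.closure {qq, qq⁻¹}

lemma qq_ne_zero : qq ≠ 0 := RatFunc.X_ne_zero

lemma qq_mem_Zq : qq ∈ Zq := Subring.subset_closure rfl

lemma qq_mem_ZqL : qq ∈ ZqL := Subring.subset_closure (by simp)

lemma qq_inv_mem_ZqL : qq⁻¹ ∈ ZqL := Subring.subset_closure (by simp)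

lemma Zq_le_ZqL : Zq ≤ ZqL := Subring.closure_mono (by simp)

/-- Polynomials in `q ^ n`: induction on the degree bound via `f (n+1) - q^d f n`. -/
lemma key (d : ℕ) : ∀ Q : K[X], (∀ m, d ≤ m → Q.coeff m = 0) →
    (∀ n : ℕ, n < d → Q.eval (qq ^ (n : ℤ)) ∈ Zq) →
    (∀ n : ℕ, Q.eval (qq ^ (n : ℤ)) ∈ Zq) ∧ (∀ n : ℤ, Q.eval (qq ^ n) ∈ ZqL) := by
  induction d with
  | zero =>
    intro Q hQ _
    have : Q = 0 := by ext m; simpa using hQ m (Nat.zero_le _)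
    subst this
    simp
  | succ d ih =>
    intro Q hQ h
    have hev : ∀ n : ℤ, (Q.comp (C qq * X) - C (qq ^ d) * Q).eval (qq ^ n)
        = Q.eval (qq ^ (n + 1)) - qq ^ d * Q.eval (qq ^ n) := by
      intro n
      rw [eval_sub, eval_comp, eval_mul, eval_mul, eval_C, eval_C, eval_X,
        zpow_add_one₀ qq_ne_zero, mul_comm qq]
    obtain ⟨h1, h2⟩ := ih (Q.comp (C qq * X) - C (qq ^ d) * Q) (by
      intro m hm
      rw [coeff_sub, comp_C_mul_X_coeff, coeff_C_mul]
      rcases hm.eq_or_lt with rfl | hm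
      · ring
      · rw [hQ m hm]; ring) (by
      intro n hn
      rw [hev]
      have := h (n + 1) (by omega)
      push_cast at this
      exact Zq.sub_mem this (Zq.mul_mem (Zq.pow_mem qq_mem_Zq _) (h n (by omega))))
    have hN : ∀ n : ℕ, Q.eval (qq ^ (n : ℤ)) ∈ Zq := by
      intro n
      induction n with
      | zero => exact h 0 (by omega)
      | succ n ihn =>
        have := Zq.add_mem (h1 n) (Zq.mul_mem (Zq.pow_mem qq_mem_Zq d) ihn)
        rw [hev, sub_add_cancel] at this
        exact_mod_cast this
    refine ⟨hN, fun n => ?_⟩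
    induction n using Int.induction_on with
    | zero => exact Zq_le_ZqL (hN 0)
    | succ n _ => exact Zq_le_ZqL (by exact_mod_cast hN (n + 1))
    | pred n ihn =>
      have := ZqL.mul_mem (ZqL.pow_mem qq_inv_mem_ZqL d) (ZqL.sub_mem ihn (h2 (-n - 1)))
      rw [hev, sub_add_cancel, sub_sub_cancel, ← mul_assoc, ← mul_pow,
        inv_mul_cancel₀ qq_ne_zero, one_pow, one_mul] at this
      exact this

/-- If a polynomial `P ∈ K[x]` of degree `d` satisfies `P([n]_q) ∈ ℤ[q]` for `n = 0,…,d`,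
then (1) `P([n]_q) ∈ ℤ[q]` for all `n ∈ ℕ`, and (2) `P([n]_q) ∈ ℤ[q,q⁻¹]` for all `n ∈ ℤ`. -/
theorem quantum_integer_valued_of_values_on_degree_range (P : K[X]) (d : ℕ)
    (hd : P.natDegree = d) (h : ∀ n : ℕ, n ≤ d → P.eval (qInt (n : ℤ)) ∈ Zq) :
    (∀ n : ℕ, P.eval (qInt (n : ℤ)) ∈ Zq) ∧ (∀ n : ℤ, P.eval (qInt n) ∈ ZqL) := by
  have hev : ∀ n : ℤ, P.eval (qInt n)
      = (P.comp (C (qq - 1)⁻¹ * (X - C 1))).eval (qq ^ n) := by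
    intro n
    rw [eval_comp, eval_mul, eval_C, eval_sub, eval_X, eval_C, qInt, div_eq_inv_mul]
  simp only [hev] at h ⊢
  refine key (d + 1) _ (fun m hm => coeff_eq_zero_of_natDegree_lt ?_)
    (fun n hn => h n (by omega))
  have h1 : (C (qq - 1)⁻¹ * (X - C 1) : K[X]).natDegree ≤ 1 :=
    (natDegree_C_mul_le _ _).trans (natDegree_X_sub_C_le _)
  have h2 := Nat.mul_le_mul_left P.natDegree h1
  have h3 := natDegree_comp_le (p := P) (q := C (qq - 1)⁻¹ * (X - C 1))
  omega
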